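/- If H is a 4-Ore graph, then T(H) = 2 if and only if H is isomorphic to H7, where H7 is the unique 4-Ore graph on seven vertices (the Ore-composition of two copies of K4) and T(H) is the maximum number of vertex-disjoint cycles of length at most four in H. -/

import Mathlib

open SimpleGraph

/-- A graph is 4-critical if it is not 3-colorable but every proper subgraph is 3-colorable. -/
def FourCritical {V : Type*} (G : SimpleGraph V) : Prop :=
  ¬ G.Colorable 3 ∧ ∀ H : SimpleGraph V, H < G → H.Colorable 3

/-- `S` is the vertex set of a cycle of length at most four in `G`. -/
def ShortCycleSet {V : Type*} (G : SimpleGraph V) (S : Set V) : Prop :=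
  ∃ (v : V) (w : G.Walk v v), w.IsCycle ∧ w.length ≤ 4 ∧ {x | x ∈ w.support} = S

/-- `maxTri G` (the quantity `T(G)` of the paper) is the maximum number of pairwise
vertex-disjoint cycles of length at most four in `G`. -/
noncomputable def maxTri {V : Type*} (G : SimpleGraph V) : ℕ :=
  sSup {n | ∃ C : Finset (Set V), C.card = n ∧ (∀ S ∈ C, ShortCycleSet G S) ∧
    (C : Set (Set V)).Pairwise Disjoint}

/-- The potential `p(G) = 5|V(G)| - 3|E(G)| - T(G)`. -/
noncomputable def pot {V : Type*} (G : SimpleGraph V) : ℤ :=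
  5 * (Nat.card V : ℤ) - 3 * (Nat.card G.edgeSet : ℤ) - (maxTri G : ℤ)

/-- The graph obtained by the Ore composition of `G₁` (edge side, replaced edge `xy`) and
`G₂` (split side, split vertex `z`, with `A` the set of neighbours of `z` assigned to the
copy `z₁` identified with `x`). -/
def oreGraph {V₁ V₂ : Type*} (G₁ : SimpleGraph V₁) (x y : V₁) (G₂ : SimpleGraph V₂)
    (z : V₂) (A : Set V₂) : SimpleGraph (V₁ ⊕ {v : V₂ // v ≠ z}) :=
  SimpleGraph.fromRel (fun a b =>
    match a, b with
    | Sum.inl a, Sum.inl b => G₁.Adj a b ∧ ¬(a = x ∧ b = y) ∧ ¬(a = y ∧ b = x)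
    | Sum.inr a, Sum.inr b => G₂.Adj a.1 b.1
    | Sum.inl a, Sum.inr b => G₂.Adj z b.1 ∧ ((a = x ∧ b.1 ∈ A) ∨ (a = y ∧ b.1 ∉ A))
    | Sum.inr _, Sum.inl _ => False)

/-- `H` is an Ore composition of `G₁` and `G₂`: an edge `xy` of `G₁` is deleted, a vertex `z`
of `G₂` is split into two vertices of positive degree, which are identified with `x` and `y`. -/
def IsOreComposition {V₁ V₂ V₃ : Type*} (H : SimpleGraph V₃) (G₁ : SimpleGraph V₁)
    (G₂ : SimpleGraph V₂) : Prop :=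
  ∃ (x y : V₁) (z : V₂) (A : Set V₂), G₁.Adj x y ∧
    (A ∩ G₂.neighborSet z).Nonempty ∧ ((G₂.neighborSet z) \ A).Nonempty ∧
    Nonempty (H ≃g oreGraph G₁ x y G₂ z A)

/-- The 4-Ore graphs on vertex sets `Fin n`: obtained from copies of `K₄` by
repeated Ore compositions. -/
inductive FourOreAux : ∀ {n : ℕ}, SimpleGraph (Fin n) → Prop
  | k4 : FourOreAux (⊤ : SimpleGraph (Fin 4))
  | ore {n₁ n₂ n : ℕ} {G₁ : SimpleGraph (Fin n₁)} {G₂ : SimpleGraph (Fin n₂)}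
      {G : SimpleGraph (Fin n)} :
      FourOreAux G₁ → FourOreAux G₂ → IsOreComposition G G₁ G₂ → FourOreAux G

/-- A graph is 4-Ore if it is isomorphic to a 4-Ore graph on some `Fin n`. -/
def IsFourOre {V : Type*} (H : SimpleGraph V) : Prop :=
  ∃ (n : ℕ) (G : SimpleGraph (Fin n)), FourOreAux G ∧ Nonempty (H ≃g G)

/-- `G` contains `K₄` minus an edge as a subgraph (vertices `a,b` of degree three in it). -/
def HasK4MinusE {V : Type*} (G : SimpleGraph V) : Prop :=
  ∃ a b c d : V, a ≠ b ∧ a ≠ c ∧ a ≠ d ∧ b ≠ c ∧ b ≠ d ∧ c ≠ d ∧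
    G.Adj a b ∧ G.Adj a c ∧ G.Adj a d ∧ G.Adj b c ∧ G.Adj b d

/-- `a,b,c,d` form a diamond of `H`: a subgraph isomorphic to `K₄ - e` (with `a,b` its
degree-three vertices) such that `a` and `b` also have degree three in `H`. -/
def IsDiamond {V : Type*} (H : SimpleGraph V) (a b c d : V) : Prop :=
  a ≠ b ∧ a ≠ c ∧ a ≠ d ∧ b ≠ c ∧ b ≠ d ∧ c ≠ d ∧
  H.Adj a b ∧ H.Adj a c ∧ H.Adj a d ∧ H.Adj b c ∧ H.Adj b d ∧
  (H.neighborSet a).ncard = 3 ∧ (H.neighborSet b).ncard = 3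

/-- Splitting the vertex `v` of `G` into two vertices `Sum.inr 0` and `Sum.inr 1`, the
neighbours of `v` in `A` going to the first and the remaining neighbours to the second. -/
def splitGraph {V : Type*} (G : SimpleGraph V) (v : V) (A : Set V) :
    SimpleGraph ({u : V // u ≠ v} ⊕ Fin 2) :=
  SimpleGraph.fromRel (fun a b =>
    match a, b with
    | Sum.inl a, Sum.inl b => G.Adj a.1 b.1
    | Sum.inl a, Sum.inr i => G.Adj v a.1 ∧ ((i = 0 ∧ a.1 ∈ A) ∨ (i = 1 ∧ a.1 ∉ A))
    | _, _ => False)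

/-- The graph `T₈` of the paper. -/
def T8 : SimpleGraph (Fin 8) :=
  SimpleGraph.fromRel (fun a b => (a, b) ∈
    ([(0,1),(1,2),(2,0),(0,3),(3,6),(6,7),(7,3),(2,4),(4,6),(6,5),(5,1),(4,7),(7,5)] :
      List (Fin 8 × Fin 8)))

/-- The graph `T₁₁` of the paper. -/
def T11 : SimpleGraph (Fin 11) :=
  SimpleGraph.fromRel (fun a b => (a, b) ∈
    ([(0,8),(8,10),(10,9),(9,1),(8,9),(10,1),(1,2),(2,0),(0,3),(3,6),(6,7),(7,3),
      (2,4),(4,6),(6,5),(5,1),(4,7),(7,5)] : List (Fin 11 × Fin 11)))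

/-- The wheel `W₅`: a 5-cycle `0,…,4` together with a hub `5` adjacent to all of it. -/
def W5 : SimpleGraph (Fin 6) :=
  SimpleGraph.fromRel (fun a b => (a, b) ∈
    ([(0,1),(1,2),(2,3),(3,4),(4,0),(5,0),(5,1),(5,2),(5,3),(5,4)] : List (Fin 6 × Fin 6)))

/-- The exceptional 4-critical graphs: `K₄`, `H₇` (the 4-Ore graph on seven vertices),
`W₅`, `T₈`, `T₁₁`, and the 4-Ore graphs with `T = 3`. -/
def Exceptional {V : Type*} (G : SimpleGraph V) : Prop :=
  Nonempty (G ≃g (⊤ : SimpleGraph (Fin 4))) ∨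
  (∃ H₇ : SimpleGraph (Fin 7), IsFourOre H₇ ∧ Nonempty (G ≃g H₇)) ∨
  Nonempty (G ≃g W5) ∨ Nonempty (G ≃g T8) ∨ Nonempty (G ≃g T11) ∨
  (IsFourOre G ∧ maxTri G = 3)

/-- `G` is a minimum counterexample to the main theorem: a 4-critical graph with
`p(G) ≥ -1` which is not exceptional, such that every 4-critical graph on fewer vertices
satisfies the conclusion of the main theorem. -/
def MinCounterexample {V : Type*} (G : SimpleGraph V) : Prop :=
  FourCritical G ∧ -1 ≤ pot G ∧ ¬ Exceptional G ∧
  ∀ m : ℕ, m < Nat.card V → ∀ H : SimpleGraph (Fin m), FourCritical H →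
    Exceptional H ∨ pot H ≤ -2

/-- The φ-identification `G_φ(R)`: the color classes of `R` are identified to the three
vertices `Sum.inr i`, which form a triangle. -/
def identGraph {V : Type*} (G : SimpleGraph V) (R : Set V) (φ : V → Fin 3) :
    SimpleGraph ({v : V // v ∉ R} ⊕ Fin 3) :=
  SimpleGraph.fromRel (fun a b =>
    match a, b with
    | Sum.inl a, Sum.inl b => G.Adj a.1 b.1
    | Sum.inl a, Sum.inr i => ∃ r ∈ R, φ r = i ∧ G.Adj a.1 r
    | Sum.inr _, Sum.inr _ => True
    | Sum.inr _, Sum.inl _ => False)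

namespace ShortCycleSet

variable {V W : Type*} {G : SimpleGraph V} {S : Set V}

theorem triangle {a b c : V} (hab : G.Adj a b) (hbc : G.Adj b c) (hca : G.Adj c a) :
    ShortCycleSet G {a, b, c} := by
  refine ⟨a, .cons hab (.cons hbc (.cons hca .nil)), ?_, by simp, ?_⟩
  · have := hab.ne
    have := hbc.ne
    have := hca.ne
    simp [Walk.cons_isCycle_iff, Walk.cons_isPath_iff]
    grind
  · ext v
    simp
    grind

theorem quadrilateral {a b c d : V} (hab : G.Adj a b) (hbc : G.Adj b c) (hcd : G.Adj c d)
    (hda : G.Adj d a) (hac : a ≠ c) (hbd : b ≠ d) : ShortCycleSet G {a, b, c, d} := by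
  refine ⟨a, .cons hab (.cons hbc (.cons hcd (.cons hda .nil))), ?_, by simp, ?_⟩
  · have := hab.ne
    have := hbc.ne
    have := hcd.ne
    have := hda.ne
    simp [Walk.cons_isCycle_iff, Walk.cons_isPath_iff]
    grind
  · ext v
    simp
    grind

theorem nonempty (h : ShortCycleSet G S) : S.Nonempty := by
  obtain ⟨v, w, -, -, rfl⟩ := h
  exact ⟨v, w.start_mem_support⟩

theorem three_le_ncard (h : ShortCycleSet G S) : 3 ≤ S.ncard := by
  classical
  obtain ⟨v, w, hw, -, rfl⟩ := h
  have hsub : (w.support.tail.toFinset : Set V) ⊆ {x | x ∈ w.support} := by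
    intro x hx
    simp only [List.coe_toFinset, Set.mem_ofPred_eq] at hx ⊢
    exact List.mem_of_mem_tail hx
  have hfin : {x | x ∈ w.support}.Finite := w.support.finite_toSet
  calc 3 ≤ w.length := hw.three_le_length
    _ = w.support.tail.toFinset.card := by
      rw [List.toFinset_card_of_nodup hw.support_nodup]; simp
    _ = (w.support.tail.toFinset : Set V).ncard := (Set.ncard_coe_finset _).symm
    _ ≤ _ := Set.ncard_le_ncard hsub hfin

theorem map {G' : SimpleGraph W} (h : ShortCycleSet G S) (f : G →g G')
    (hf : Function.Injective f) : ShortCycleSet G' (f '' S) := by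
  obtain ⟨v, w, hw, hlen, rfl⟩ := h
  refine ⟨f v, w.map f, hw.map hf, by simpa using hlen, ?_⟩
  ext x
  simp

theorem transfer {G' : SimpleGraph V} {z : V} (h : ShortCycleSet G S) (hz : z ∉ S)
    (hG : ∀ p q, p ≠ z → q ≠ z → G.Adj p q → G'.Adj p q) : ShortCycleSet G' S := by
  obtain ⟨v, w, hw, hlen, rfl⟩ := h
  have hedges : ∀ e ∈ w.edges, e ∈ G'.edgeSet := by
    intro e
    induction e with
    | _ p q =>
      intro he
      refine hG p q ?_ ?_ (w.adj_of_mem_edges he)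
      · rintro rfl
        exact hz (w.fst_mem_support_of_mem_edges he)
      · rintro rfl
        exact hz (w.snd_mem_support_of_mem_edges he)
  exact ⟨v, w.transfer G' hedges, hw.transfer hedges, by simpa using hlen, by simp⟩

end ShortCycleSet

/-- `G` contains at least `k` pairwise vertex-disjoint cycles of length at most four. -/
def HasShortCyclePacking {V : Type*} (G : SimpleGraph V) (k : ℕ) : Prop :=
  ∃ C : Finset (Set V), k ≤ C.card ∧ (∀ S ∈ C, ShortCycleSet G S) ∧
    (C : Set (Set V)).Pairwise Disjoint

theorem three_mul_card_le_of_pairwise_disjoint {V : Type*} [Finite V] {G : SimpleGraph V}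
    {C : Finset (Set V)} (hC : ∀ S ∈ C, ShortCycleSet G S)
    (hd : (C : Set (Set V)).Pairwise Disjoint) : 3 * C.card ≤ Nat.card V := by
  classical
  cases nonempty_fintype V
  have hcard := Finset.card_biUnion (s := C) (t := fun S => S.toFinset)
    (fun S hS T hT hST => by
      simpa [Function.onFun] using hd hS hT hST)
  calc 3 * C.card = ∑ _S ∈ C, 3 := by simp [mul_comm]
    _ ≤ ∑ S ∈ C, S.toFinset.card := Finset.sum_le_sum fun S hS => by
      rw [← Set.ncard_eq_toFinset_card']
      exact (hC S hS).three_le_ncard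
    _ = _ := hcard.symm
    _ ≤ Fintype.card V := Finset.card_le_univ _
    _ = Nat.card V := Nat.card_eq_fintype_card.symm

theorem bddAbove_shortCyclePacking_card {V : Type*} [Finite V] (G : SimpleGraph V) :
    BddAbove {n | ∃ C : Finset (Set V), C.card = n ∧ (∀ S ∈ C, ShortCycleSet G S) ∧
      (C : Set (Set V)).Pairwise Disjoint} := by
  refine ⟨Nat.card V, ?_⟩
  rintro _ ⟨C, rfl, hC, hd⟩
  have := three_mul_card_le_of_pairwise_disjoint hC hd
  omega

theorem three_mul_maxTri_le {V : Type*} [Finite V] (G : SimpleGraph V) :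
    3 * maxTri G ≤ Nat.card V := by
  have : maxTri G ≤ Nat.card V / 3 := by
    refine csSup_le' ?_
    rintro _ ⟨C, rfl, hC, hd⟩
    have := three_mul_card_le_of_pairwise_disjoint hC hd
    omega
  omega

namespace HasShortCyclePacking

variable {V W : Type*} {G : SimpleGraph V} {k : ℕ}

theorem le_maxTri [Finite V] (h : HasShortCyclePacking G k) : k ≤ maxTri G := by
  obtain ⟨C, hk, hC⟩ := h
  exact hk.trans (le_csSup (bddAbove_shortCyclePacking_card G) ⟨C, rfl, hC⟩)

theorem pair {S T : Set V} (hS : ShortCycleSet G S) (hT : ShortCycleSet G T)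
    (hd : Disjoint S T) : HasShortCyclePacking G 2 := by
  classical
  have hne : S ≠ T := by
    rintro rfl
    exact hS.nonempty.ne_empty (disjoint_self.1 hd)
  refine ⟨{S, T}, by simp [hne], by simp [hS, hT], ?_⟩
  simp [Set.pairwise_pair_of_symm, hd]

theorem map {G' : SimpleGraph W} (h : HasShortCyclePacking G k) (f : G →g G')
    (hf : Function.Injective f) : HasShortCyclePacking G' k := by
  classical
  obtain ⟨C, hk, hC, hd⟩ := h
  refine ⟨C.image (f '' ·), ?_, ?_, ?_⟩
  · rwa [Finset.card_image_of_injective _ hf.image_injective]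
  · simp only [Finset.mem_image]
    rintro _ ⟨S, hS, rfl⟩
    exact (hC S hS).map f hf
  · simp only [Finset.coe_image]
    rintro _ ⟨S, hS, rfl⟩ _ ⟨T, hT, rfl⟩ hne
    exact (Set.disjoint_image_iff hf).2 (hd hS hT fun h => hne (by rw [h]))

theorem insert {S : Set V} (h : ShortCycleSet G S) {C : Finset (Set V)}
    (hk : k ≤ C.card) (hC : ∀ T ∈ C, ShortCycleSet G T)
    (hd : (C : Set (Set V)).Pairwise Disjoint) (hS : ∀ T ∈ C, Disjoint S T) :
    HasShortCyclePacking G (k + 1) := by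
  classical
  have hne : S ∉ C := fun hm => h.nonempty.ne_empty (disjoint_self.1 (hS S hm))
  refine ⟨Insert.insert S C, ?_, ?_, ?_⟩
  · rw [Finset.card_insert_of_notMem hne]
    omega
  · simpa using ⟨h, hC⟩
  · rw [Finset.coe_insert]
    exact hd.insert_of_symm fun T hT _ => hS T hT

/-- Changing edges at a single vertex destroys at most one of the packed cycles. -/
theorem transfer {G' : SimpleGraph V} (h : HasShortCyclePacking G (k + 1)) (z : V)
    (hG : ∀ p q, p ≠ z → q ≠ z → G.Adj p q → G'.Adj p q) : HasShortCyclePacking G' k := by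
  classical
  obtain ⟨C, hk, hC, hd⟩ := h
  have hone : (C.filter (z ∈ ·)).card ≤ 1 := by
    refine Finset.card_le_one.2 fun S hS T hT => ?_
    rw [Finset.mem_filter] at hS hT
    by_contra hne
    exact Set.disjoint_left.1 (hd hS.1 hT.1 hne) hS.2 hT.2
  refine ⟨C.filter (z ∉ ·), ?_, ?_, ?_⟩
  · have := C.card_filter_add_card_filter_not (z ∈ ·)
    omega
  · intro S hS
    rw [Finset.mem_filter] at hS
    exact (hC S hS.1).transfer hS.2 hG
  · exact hd.mono (Finset.coe_subset.2 (C.filter_subset _))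

theorem exists_notMem (h : HasShortCyclePacking G 2) (z : V) :
    ∃ S, ShortCycleSet G S ∧ z ∉ S := by
  obtain ⟨C, hk, hC, hd⟩ := h
  obtain ⟨S, hS, T, hT, hne⟩ := Finset.one_lt_card.1 hk
  by_cases hz : z ∈ S
  · exact ⟨T, hC T hT, Set.disjoint_left.1 (hd hS hT hne) hz⟩
  · exact ⟨S, hC S hS, hz⟩

end HasShortCyclePacking

/-- Delete from `G` the edges joining `z` to a vertex of `B`. -/
def cutAt {V : Type*} (G : SimpleGraph V) (z : V) (B : Set V) : SimpleGraph V where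
  Adj a b := G.Adj a b ∧ ¬(a = z ∧ b ∈ B) ∧ ¬(b = z ∧ a ∈ B)
  symm := ⟨fun _ _ h => ⟨h.1.symm, h.2.2, h.2.1⟩⟩
  loopless := ⟨fun _ h => h.1.ne rfl⟩

/-- Two disjoint short cycles survive the deletion of any edge, and survive in one of the two
halves arising from any splitting of a vertex. -/
def IsRobust {V : Type*} (G : SimpleGraph V) : Prop :=
  (∀ x y, HasShortCyclePacking (cutAt G x {y}) 2) ∧
    ∀ z A, HasShortCyclePacking (cutAt G z A) 2 ∨ HasShortCyclePacking (cutAt G z Aᶜ) 2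

theorem adj_cutAt_of_ne {V : Type*} {G : SimpleGraph V} {z : V} {B : Set V} (p q : V)
    (hp : p ≠ z) (hq : q ≠ z) (h : G.Adj p q) : (cutAt G z B).Adj p q :=
  ⟨h, fun hz => hp hz.1, fun hz => hq hz.1⟩

theorem HasShortCyclePacking.isRobust {V : Type*} {G : SimpleGraph V}
    (h : HasShortCyclePacking G 3) : IsRobust G :=
  ⟨fun x _ => h.transfer x adj_cutAt_of_ne, fun z _ => .inl (h.transfer z adj_cutAt_of_ne)⟩

theorem IsRobust.hasShortCyclePacking_two {V : Type*} [Nonempty V] {G : SimpleGraph V}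
    (h : IsRobust G) : HasShortCyclePacking G 2 :=
  have v := Classical.arbitrary V
  (h.1 v v).map ⟨id, fun h => h.1⟩ Function.injective_id

theorem IsRobust.map {V W : Type*} {G : SimpleGraph V} {G' : SimpleGraph W} (h : IsRobust G)
    (f : G →g G') (hf : Function.Bijective f) : IsRobust G' := by
  have key : ∀ z A, HasShortCyclePacking (cutAt G z (f ⁻¹' A)) 2 →
      HasShortCyclePacking (cutAt G' (f z) A) 2 := fun z A hp =>
    hp.map ⟨f, fun {a b} hab => ⟨f.map_adj hab.1, fun hc => hab.2.1 ⟨hf.1 hc.1, hc.2⟩,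
      fun hc => hab.2.2 ⟨hf.1 hc.1, hc.2⟩⟩⟩ hf.1
  constructor
  · intro x y
    obtain ⟨x, rfl⟩ := hf.2 x
    obtain ⟨y, rfl⟩ := hf.2 y
    refine key x {f y} ?_
    have : f ⁻¹' {f y} = {y} := by
      ext v
      simp [hf.1.eq_iff]
    rw [this]
    exact h.1 x y
  · intro z A
    obtain ⟨z, rfl⟩ := hf.2 z
    exact (h.2 z (f ⁻¹' A)).imp (key z A) (key z Aᶜ)

/-- The Ore composition of two copies of `K₄`: a diamond `0, 2, 3, 1` and a triangle `4, 5, 6`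
joined by three edges. -/
def oreSeven : SimpleGraph (Fin 7) :=
  SimpleGraph.fromRel (fun a b => (a, b) ∈
    ([(0,2),(0,3),(1,2),(1,3),(2,3),(4,5),(4,6),(5,6),(0,4),(1,5),(1,6)] :
      List (Fin 7 × Fin 7)))

theorem isRobust_oreSeven : IsRobust oreSeven := by
  have triangles (K : SimpleGraph (Fin 7)) {a b c d e f : Fin 7}
      (hab : K.Adj a b) (hbc : K.Adj b c) (hca : K.Adj c a) (hde : K.Adj d e)
      (hef : K.Adj e f) (hfd : K.Adj f d)
      (hd : Disjoint ({a, b, c} : Set (Fin 7)) {d, e, f}) : HasShortCyclePacking K 2 :=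
    .pair (.triangle hab hbc hca) (.triangle hde hef hfd) hd
  have mixed (K : SimpleGraph (Fin 7)) {a b c d e f g : Fin 7}
      (hab : K.Adj a b) (hbc : K.Adj b c) (hcd : K.Adj c d) (hda : K.Adj d a) (hac : a ≠ c)
      (hbd : b ≠ d) (hef : K.Adj e f) (hfg : K.Adj f g) (hge : K.Adj g e)
      (hd : Disjoint ({a, b, c, d} : Set (Fin 7)) {e, f, g}) : HasShortCyclePacking K 2 :=
    .pair (.quadrilateral hab hbc hcd hda hac hbd) (.triangle hef hfg hge) hd
  constructor
  · intro x y
    by_cases h₁ : s(x, y) = s(2, 3)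
    · refine mixed _ (a := 0) (b := 2) (c := 1) (d := 3) (e := 4) (f := 5) (g := 6)
        ?_ ?_ ?_ ?_ ?_ ?_ ?_ ?_ ?_ ?_ <;> simp [cutAt, oreSeven] at h₁ ⊢ <;> grind
    by_cases h₂ : s(x, y) = s(5, 6)
    · refine mixed _ (a := 4) (b := 5) (c := 1) (d := 6) (e := 0) (f := 2) (g := 3)
        ?_ ?_ ?_ ?_ ?_ ?_ ?_ ?_ ?_ ?_ <;> simp [cutAt, oreSeven] at h₂ ⊢ <;> grind
    by_cases h₃ : s(x, y) ∈ ({s(1, 2), s(1, 3), s(4, 5), s(4, 6)} : Set (Sym2 (Fin 7)))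
    · refine triangles _ (a := 0) (b := 2) (c := 3) (d := 1) (e := 5) (f := 6)
        ?_ ?_ ?_ ?_ ?_ ?_ ?_ <;> simp [cutAt, oreSeven] at h₁ h₂ h₃ ⊢ <;> grind
    · refine triangles _ (a := 1) (b := 2) (c := 3) (d := 4) (e := 5) (f := 6)
        ?_ ?_ ?_ ?_ ?_ ?_ ?_ <;> simp [cutAt, oreSeven] at h₁ h₂ h₃ ⊢ <;> grind
  · intro z A
    have key (z p q r : Fin 7)
        (hpq : ∀ B : Set (Fin 7), p ∉ B → q ∉ B → HasShortCyclePacking (cutAt oreSeven z B) 2)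
        (hpr : ∀ B : Set (Fin 7), p ∉ B → r ∉ B → HasShortCyclePacking (cutAt oreSeven z B) 2)
        (hqr : ∀ B : Set (Fin 7), q ∉ B → r ∉ B → HasShortCyclePacking (cutAt oreSeven z B) 2) :
        HasShortCyclePacking (cutAt oreSeven z A) 2 ∨
          HasShortCyclePacking (cutAt oreSeven z Aᶜ) 2 := by
      have hA : ∀ {v}, v ∈ A → v ∉ Aᶜ := not_not.2
      by_cases hp : p ∈ A <;> by_cases hq : q ∈ A
      · exact .inr (hpq _ (hA hp) (hA hq))
      · by_cases hr : r ∈ A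
        · exact .inr (hpr _ (hA hp) (hA hr))
        · exact .inl (hqr _ hq hr)
      · by_cases hr : r ∈ A
        · exact .inr (hqr _ (hA hq) (hA hr))
        · exact .inl (hpr _ hp hr)
      · exact .inl (hpq _ hp hq)
    have quad₁ (z : Fin 7) (B : Set (Fin 7)) (h : (z = 2 ∨ z = 3) ∧ 0 ∉ B ∧ 1 ∉ B) :
        HasShortCyclePacking (cutAt oreSeven z B) 2 := by
      refine mixed _ (a := 0) (b := 2) (c := 1) (d := 3) (e := 4) (f := 5) (g := 6)
        ?_ ?_ ?_ ?_ ?_ ?_ ?_ ?_ ?_ ?_ <;> simp [cutAt, oreSeven] <;> grind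
    have quad₂ (z : Fin 7) (B : Set (Fin 7)) (h : (z = 5 ∨ z = 6) ∧ 1 ∉ B ∧ 4 ∉ B) :
        HasShortCyclePacking (cutAt oreSeven z B) 2 := by
      refine mixed _ (a := 4) (b := 5) (c := 1) (d := 6) (e := 0) (f := 2) (g := 3)
        ?_ ?_ ?_ ?_ ?_ ?_ ?_ ?_ ?_ ?_ <;> simp [cutAt, oreSeven] <;> grind
    have tri₁ (z : Fin 7) (B : Set (Fin 7))
        (h : z = 4 ∨ z = 5 ∧ 1 ∉ B ∧ 6 ∉ B ∨ z = 6 ∧ 1 ∉ B ∧ 5 ∉ B) :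
        HasShortCyclePacking (cutAt oreSeven z B) 2 := by
      refine triangles _ (a := 0) (b := 2) (c := 3) (d := 1) (e := 5) (f := 6)
        ?_ ?_ ?_ ?_ ?_ ?_ ?_ <;> simp [cutAt, oreSeven] <;> grind
    have tri₂ (z : Fin 7) (B : Set (Fin 7))
        (h : z = 0 ∨ z = 2 ∧ 1 ∉ B ∧ 3 ∉ B ∨ z = 3 ∧ 1 ∉ B ∧ 2 ∉ B) :
        HasShortCyclePacking (cutAt oreSeven z B) 2 := by
      refine triangles _ (a := 1) (b := 2) (c := 3) (d := 4) (e := 5) (f := 6)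
        ?_ ?_ ?_ ?_ ?_ ?_ ?_ <;> simp [cutAt, oreSeven] <;> grind
    have tri₃ (z : Fin 7) (B : Set (Fin 7))
        (h : z = 1 ∨ z = 2 ∧ 0 ∉ B ∧ 3 ∉ B ∨ z = 3 ∧ 0 ∉ B ∧ 2 ∉ B ∨
          z = 5 ∧ 4 ∉ B ∧ 6 ∉ B ∨ z = 6 ∧ 4 ∉ B ∧ 5 ∉ B) :
        HasShortCyclePacking (cutAt oreSeven z B) 2 := by
      refine triangles _ (a := 0) (b := 2) (c := 3) (d := 4) (e := 5) (f := 6)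
        ?_ ?_ ?_ ?_ ?_ ?_ ?_ <;> simp [cutAt, oreSeven] <;> grind
    obtain rfl | rfl | rfl | rfl | rfl | rfl | rfl :
        z = 0 ∨ z = 1 ∨ z = 4 ∨ z = 2 ∨ z = 3 ∨ z = 5 ∨ z = 6 := by
      clear * -
      decide +revert
    · exact .inl (tri₂ _ _ (by simp))
    · exact .inl (tri₃ _ _ (by simp))
    · exact .inl (tri₁ _ _ (by simp))
    · exact key 2 0 1 3 (fun B _ _ => quad₁ _ _ (by simp [*])) (fun B _ _ => tri₃ _ _ (by simp [*]))
        fun B _ _ => tri₂ _ _ (by simp [*])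
    · exact key 3 0 1 2 (fun B _ _ => quad₁ _ _ (by simp [*])) (fun B _ _ => tri₃ _ _ (by simp [*]))
        fun B _ _ => tri₂ _ _ (by simp [*])
    · exact key 5 1 4 6 (fun B _ _ => quad₂ _ _ (by simp [*])) (fun B _ _ => tri₁ _ _ (by simp [*]))
        fun B _ _ => tri₃ _ _ (by simp [*])
    · exact key 6 1 4 5 (fun B _ _ => quad₂ _ _ (by simp [*])) (fun B _ _ => tri₁ _ _ (by simp [*]))
        fun B _ _ => tri₃ _ _ (by simp [*])

/-- The inclusion of the split side into an Ore composition that sends `z` to `w`. -/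
noncomputable def oreSplitMap {V₁ V₂ : Type*} (w : V₁) (z : V₂) (v : V₂) :
    V₁ ⊕ {v : V₂ // v ≠ z} :=
  open Classical in if h : v = z then .inl w else .inr ⟨v, h⟩

theorem oreSplitMap_injective {V₁ V₂ : Type*} (w : V₁) (z : V₂) :
    Function.Injective (oreSplitMap w z) := by
  intro a b h
  unfold oreSplitMap at h
  split_ifs at h <;> simp_all

theorem disjoint_image_inl_oreSplitMap {V₁ V₂ : Type*} {w : V₁} {z : V₂} {S : Set V₁}
    {T : Set V₂} (h : w ∉ S ∨ z ∉ T) : Disjoint (Sum.inl '' S) (oreSplitMap w z '' T) := by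
  rw [Set.disjoint_left]
  rintro _ ⟨a, ha, rfl⟩ ⟨b, hb, hab⟩
  unfold oreSplitMap at hab
  split_ifs at hab
  simp_all

section OreGraph

variable {V₁ V₂ : Type*} {G₁ : SimpleGraph V₁} {G₂ : SimpleGraph V₂} {x y : V₁} {z : V₂}
  {A : Set V₂}

theorem oreGraph_adj_inl {a b : V₁} (h : (cutAt G₁ x {y}).Adj a b) :
    (oreGraph G₁ x y G₂ z A).Adj (.inl a) (.inl b) := by
  obtain ⟨h, h1, h2⟩ := h
  simp [oreGraph, h, h.ne]
  grind

theorem oreGraph_adj_left {w : V₂} (hw : w ≠ z) (h : G₂.Adj z w) (hA : w ∈ A) :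
    (oreGraph G₁ x y G₂ z A).Adj (.inl x) (.inr ⟨w, hw⟩) := by
  simp [oreGraph, h, hA]

theorem oreGraph_adj_right {w : V₂} (hw : w ≠ z) (h : G₂.Adj z w) (hA : w ∉ A) :
    (oreGraph G₁ x y G₂ z A).Adj (.inl y) (.inr ⟨w, hw⟩) := by
  simp [oreGraph, h, hA]

theorem oreGraph_adj_inr {v w : V₂} (hv : v ≠ z) (hw : w ≠ z) (h : G₂.Adj v w) :
    (oreGraph G₁ x y G₂ z A).Adj (.inr ⟨v, hv⟩) (.inr ⟨w, hw⟩) := by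
  simp [oreGraph, h, h.ne]

variable (G₁ G₂ x y z A)

theorem oreSplitMap_hom_left {a b : V₂} (h : (cutAt G₂ z Aᶜ).Adj a b) :
    (oreGraph G₁ x y G₂ z A).Adj (oreSplitMap x z a) (oreSplitMap x z b) := by
  obtain ⟨h, h1, h2⟩ := h
  unfold oreSplitMap
  split_ifs with ha hb hb
  · exact absurd (ha.trans hb.symm) h.ne
  · exact oreGraph_adj_left hb (ha ▸ h) (by simpa [ha] using h1)
  · exact (oreGraph_adj_left ha (hb ▸ h.symm) (by simpa [hb] using h2)).symm
  · exact oreGraph_adj_inr ha hb h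

theorem oreSplitMap_hom_right {a b : V₂} (h : (cutAt G₂ z A).Adj a b) :
    (oreGraph G₁ x y G₂ z A).Adj (oreSplitMap y z a) (oreSplitMap y z b) := by
  obtain ⟨h, h1, h2⟩ := h
  unfold oreSplitMap
  split_ifs with ha hb hb
  · exact absurd (ha.trans hb.symm) h.ne
  · exact oreGraph_adj_right hb (ha ▸ h) (by simpa [ha] using h1)
  · exact (oreGraph_adj_right ha (hb ▸ h.symm) (by simpa [hb] using h2)).symm
  · exact oreGraph_adj_inr ha hb h

variable {G₁ G₂ x y z A}

theorem ShortCycleSet.oreGraph_inl {S : Set V₁} (h : ShortCycleSet (cutAt G₁ x {y}) S) :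
    ShortCycleSet (oreGraph G₁ x y G₂ z A) (Sum.inl '' S) :=
  h.map ⟨Sum.inl, fun h => oreGraph_adj_inl h⟩ Sum.inl_injective

theorem hasShortCyclePacking_oreGraph_of_edge_side
    (h₁ : HasShortCyclePacking (cutAt G₁ x {y}) 2) (h₂ : ∃ S, ShortCycleSet G₂ S ∧ z ∉ S) :
    HasShortCyclePacking (oreGraph G₁ x y G₂ z A) 3 := by
  classical
  obtain ⟨C, hk, hC, hd⟩ := h₁
  obtain ⟨S, hS, hz⟩ := h₂
  have hS' : ShortCycleSet (oreGraph G₁ x y G₂ z A) (oreSplitMap x z '' S) :=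
    (hS.transfer hz adj_cutAt_of_ne).map
      ⟨oreSplitMap x z, fun h => oreSplitMap_hom_left G₁ G₂ x y z A h⟩ (oreSplitMap_injective x z)
  refine .insert hS' (C := C.image (Sum.inl '' ·)) ?_ ?_ ?_ ?_
  · rwa [Finset.card_image_of_injective _ Sum.inl_injective.image_injective]
  · simp only [Finset.mem_image]
    rintro _ ⟨T, hT, rfl⟩
    exact (hC T hT).oreGraph_inl
  · simp only [Finset.coe_image]
    rintro _ ⟨S, hS, rfl⟩ _ ⟨T, hT, rfl⟩ hne
    exact (Set.disjoint_image_iff Sum.inl_injective).2 (hd hS hT fun h => hne (by rw [h]))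
  · simp only [Finset.mem_image]
    rintro _ ⟨T, hT, rfl⟩
    exact (disjoint_image_inl_oreSplitMap (.inr hz)).symm

theorem hasShortCyclePacking_oreGraph_of_half {G' : SimpleGraph V₂} {w : V₁}
    (h₁ : ∃ S, ShortCycleSet (cutAt G₁ x {y}) S ∧ w ∉ S) (h₂ : HasShortCyclePacking G' 2)
    (hw : ∀ {a b}, G'.Adj a b →
      (oreGraph G₁ x y G₂ z A).Adj (oreSplitMap w z a) (oreSplitMap w z b)) :
    HasShortCyclePacking (oreGraph G₁ x y G₂ z A) 3 := by
  classical
  obtain ⟨C, hk, hC, hd⟩ := h₂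
  obtain ⟨S, hS, hwS⟩ := h₁
  have hinj := oreSplitMap_injective w z
  refine .insert hS.oreGraph_inl (C := C.image (oreSplitMap w z '' ·)) ?_ ?_ ?_ ?_
  · rwa [Finset.card_image_of_injective _ hinj.image_injective]
  · simp only [Finset.mem_image]
    rintro _ ⟨T, hT, rfl⟩
    exact (hC T hT).map ⟨oreSplitMap w z, hw⟩ hinj
  · simp only [Finset.coe_image]
    rintro _ ⟨S, hS, rfl⟩ _ ⟨T, hT, rfl⟩ hne
    exact (Set.disjoint_image_iff hinj).2 (hd hS hT fun h => hne (by rw [h]))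
  · simp only [Finset.mem_image]
    rintro _ ⟨T, hT, rfl⟩
    exact disjoint_image_inl_oreSplitMap (.inl hwS)

theorem hasShortCyclePacking_oreGraph_of_split_side (h₁ : ∀ v, ∃ S, ShortCycleSet G₁ S ∧ v ∉ S)
    (h₂ : IsRobust G₂) : HasShortCyclePacking (oreGraph G₁ x y G₂ z A) 3 := by
  rcases h₂.2 z A with h | h
  · obtain ⟨S, hS, hy⟩ := h₁ y
    refine hasShortCyclePacking_oreGraph_of_half (w := y) ⟨S, hS.transfer hy ?_, hy⟩ h
      (oreSplitMap_hom_right G₁ G₂ x y z A)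
    exact fun p q hp hq h => ⟨h, fun hc => hq hc.2, fun hc => hp hc.2⟩
  · obtain ⟨S, hS, hx⟩ := h₁ x
    exact hasShortCyclePacking_oreGraph_of_half (w := x)
      ⟨S, hS.transfer hx adj_cutAt_of_ne, hx⟩ h (oreSplitMap_hom_left G₁ G₂ x y z A)

end OreGraph

theorem exists_shortCycleSet_top_notMem (z : Fin 4) :
    ∃ S, ShortCycleSet (⊤ : SimpleGraph (Fin 4)) S ∧ z ∉ S := by
  obtain ⟨a, b, c, hab, hbc, hca, ha, hb, hc⟩ :
      ∃ a b c : Fin 4, a ≠ b ∧ b ≠ c ∧ c ≠ a ∧ z ≠ a ∧ z ≠ b ∧ z ≠ c := by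
    decide +revert
  exact ⟨{a, b, c}, .triangle hab hbc hca, by simp [ha, hb, hc]⟩

theorem isRobust_of_oreSeven_adj {V : Type*} [Finite V] {G : SimpleGraph V}
    (hcard : Nat.card V = 7) (f : Fin 7 → V) (hf : Function.Injective f)
    (hadj : ∀ p ∈ ([(0,2),(0,3),(1,2),(1,3),(2,3),(4,5),(4,6),(5,6),(0,4),(1,5),(1,6)] :
      List (Fin 7 × Fin 7)), G.Adj (f p.1) (f p.2)) : IsRobust G := by
  refine isRobust_oreSeven.map ⟨f, ?_⟩ (hf.bijective_of_nat_card_le (by simp [hcard]))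
  rintro a b ⟨-, h | h⟩
  · exact hadj _ h
  · exact (hadj _ h).symm

theorem natCard_oreGraph {n₁ n₂ : ℕ} (z : Fin n₂) :
    Nat.card (Fin n₁ ⊕ {v : Fin n₂ // v ≠ z}) = n₁ + (n₂ - 1) := by
  simp [Fintype.card_subtype_compl]

theorem isRobust_oreGraph_top {x y z : Fin 4} {A : Set (Fin 4)} (hxy : x ≠ y)
    (hA : (A ∩ (⊤ : SimpleGraph (Fin 4)).neighborSet z).Nonempty)
    (hA' : ((⊤ : SimpleGraph (Fin 4)).neighborSet z \ A).Nonempty) :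
    IsRobust (oreGraph (⊤ : SimpleGraph (Fin 4)) x y ⊤ z A) := by
  obtain ⟨a, b, hab, hax, hay, hbx, hby⟩ :
      ∃ a b : Fin 4, a ≠ b ∧ a ≠ x ∧ a ≠ y ∧ b ≠ x ∧ b ≠ y := by
    clear hA hA'
    decide +revert
  obtain ⟨c, hcA, hc⟩ := hA
  obtain ⟨d, hd, hdA⟩ := hA'
  have hcz : c ≠ z := Ne.symm hc
  have hdz : d ≠ z := Ne.symm hd
  have hcd : c ≠ d := by
    rintro rfl
    exact hdA hcA
  obtain ⟨e, hez, hec, hed⟩ : ∃ e : Fin 4, e ≠ z ∧ e ≠ c ∧ e ≠ d := by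
    clear * -
    decide +revert
  have hinl : ∀ p q : Fin 4, p ≠ q → ¬(p = x ∧ q = y) → ¬(p = y ∧ q = x) →
      (oreGraph (⊤ : SimpleGraph (Fin 4)) x y ⊤ z A).Adj (.inl p) (.inl q) :=
    fun p q h h1 h2 => oreGraph_adj_inl ⟨h, h1, fun hc => h2 ⟨hc.2, hc.1⟩⟩
  have hinr : ∀ p q : Fin 4, ∀ hp hq, p ≠ q →
      (oreGraph (⊤ : SimpleGraph (Fin 4)) x y ⊤ z A).Adj (.inr ⟨p, hp⟩) (.inr ⟨q, hq⟩) :=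
    fun p q hp hq h => oreGraph_adj_inr hp hq h
  have hleft : ∀ p : Fin 4, ∀ hp : p ≠ z, p ∈ A →
      (oreGraph (⊤ : SimpleGraph (Fin 4)) x y ⊤ z A).Adj (.inl x) (.inr ⟨p, hp⟩) :=
    fun p hp h => oreGraph_adj_left hp hp.symm h
  have hright : ∀ p : Fin 4, ∀ hp : p ≠ z, p ∉ A →
      (oreGraph (⊤ : SimpleGraph (Fin 4)) x y ⊤ z A).Adj (.inl y) (.inr ⟨p, hp⟩) :=
    fun p hp h => oreGraph_adj_right hp hp.symm h
  by_cases heA : e ∈ A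
  · refine isRobust_of_oreSeven_adj (natCard_oreGraph z)
      ![.inl y, .inl x, .inl a, .inl b, .inr ⟨d, hdz⟩, .inr ⟨c, hcz⟩, .inr ⟨e, hez⟩] ?_ ?_
    · intro i j
      fin_cases i <;> fin_cases j <;> simp <;> grind
    · simp
      grind
  · refine isRobust_of_oreSeven_adj (natCard_oreGraph z)
      ![.inl x, .inl y, .inl a, .inl b, .inr ⟨c, hcz⟩, .inr ⟨d, hdz⟩, .inr ⟨e, hez⟩] ?_ ?_
    · intro i j
      fin_cases i <;> fin_cases j <;> simp <;> grind
    · simp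
      grind

theorem FourOreAux.eq_top_or_isRobust {n : ℕ} {G : SimpleGraph (Fin n)} (h : FourOreAux G) :
    (n = 4 ∧ G = ⊤) ∨ (n = 7 ∧ IsRobust G) ∨ (7 < n ∧ HasShortCyclePacking G 3) := by
  induction h with
  | k4 => exact .inl ⟨rfl, rfl⟩
  | @ore n₁ n₂ n G₁ G₂ G _ _ hcomp ih₁ ih₂ =>
    obtain ⟨x, y, z, A, hxy, hA, hA', ⟨e⟩⟩ := hcomp
    have hn : n = n₁ + (n₂ - 1) := by
      rw [← natCard_oreGraph (n₁ := n₁) z, ← Nat.card_congr e.toEquiv, Nat.card_fin]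
    replace ih₁ : (n₁ = 4 ∧ G₁ = ⊤) ∨ (7 ≤ n₁ ∧ IsRobust G₁) :=
      ih₁.imp_right (Or.elim · (fun h => ⟨h.1.ge, h.2⟩) fun h => ⟨h.1.le, h.2.isRobust⟩)
    replace ih₂ : (n₂ = 4 ∧ G₂ = ⊤) ∨ (7 ≤ n₂ ∧ IsRobust G₂) :=
      ih₂.imp_right (Or.elim · (fun h => ⟨h.1.ge, h.2⟩) fun h => ⟨h.1.le, h.2.isRobust⟩)
    right
    have avoid : ∀ {m : ℕ} {K : SimpleGraph (Fin m)}, (m = 4 ∧ K = ⊤) ∨ (7 ≤ m ∧ IsRobust K) →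
        ∀ v, ∃ S, ShortCycleSet K S ∧ v ∉ S := by
      rintro m K (⟨rfl, rfl⟩ | ⟨hm, hK⟩) v
      · exact exists_shortCycleSet_top_notMem v
      · have : Nonempty (Fin m) := ⟨v⟩
        exact hK.hasShortCyclePacking_two.exists_notMem v
    have a₁ := avoid ih₁
    have a₂ := avoid ih₂
    rcases ih₁ with ⟨rfl, rfl⟩ | ⟨hn₁, h₁⟩
    · rcases ih₂ with ⟨rfl, rfl⟩ | ⟨hn₂, h₂⟩
      · exact .inl ⟨hn, (isRobust_oreGraph_top hxy hA hA').map e.symm.toHom e.symm.bijective⟩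
      · exact .inr ⟨by omega, (hasShortCyclePacking_oreGraph_of_split_side a₁ h₂).map
          e.symm.toHom e.symm.injective⟩
    · have : 4 ≤ n₂ := by omega
      exact .inr ⟨by omega, (hasShortCyclePacking_oreGraph_of_edge_side (h₁.1 x y) (a₂ z)).map
        e.symm.toHom e.symm.injective⟩

/-- For a 4-Ore graph `H`, `T(H) = 2` if and only if `H` is isomorphic to `H₇`, the
(unique) 4-Ore graph on seven vertices. -/
theorem fourOre_T_eq_two_iff {V : Type*} (H : SimpleGraph V) (hH : IsFourOre H) :
    maxTri H = 2 ↔ ∃ H₇ : SimpleGraph (Fin 7), IsFourOre H₇ ∧ Nonempty (H ≃g H₇) := by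
  obtain ⟨n, G, hG, ⟨e⟩⟩ := hH
  have : Finite V := .of_equiv _ e.toEquiv.symm
  have hcard : Nat.card V = n := by rw [Nat.card_congr e.toEquiv, Nat.card_fin]
  have hle := three_mul_maxTri_le H
  constructor
  · intro hT
    obtain ⟨rfl, -⟩ | ⟨rfl, -⟩ | ⟨-, hG3⟩ := hG.eq_top_or_isRobust
    · omega
    · exact ⟨G, ⟨7, G, hG, ⟨.refl⟩⟩, ⟨e⟩⟩
    · have := (hG3.map e.symm.toHom e.symm.injective).le_maxTri
      omega
  · rintro ⟨H₇, -, ⟨e'⟩⟩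
    have h7 : Nat.card V = 7 := by rw [Nat.card_congr e'.toEquiv, Nat.card_fin]
    obtain rfl : n = 7 := hcard.symm.trans h7
    obtain ⟨h, -⟩ | ⟨-, hG2⟩ | ⟨h, -⟩ := hG.eq_top_or_isRobust
    · omega
    · have := (hG2.hasShortCyclePacking_two.map e.symm.toHom e.symm.injective).le_maxTri
      omega
    · omega
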